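/- Let f be a homogeneous polynomial of degree 6 in ℂ[x₁,x₂,x₃] such that Hess(f) vanishes at the four points (0,0,1), (0,1,0), (1,0,0), and (1,1,0) (the last three of which lie on the line x₃ = 0). Then f is divisible by x₃². -/

import Mathlib

open MvPolynomial

noncomputable section

/-- The Hessian matrix of `f` (the matrix of second partial derivatives) vanishes at `p`. -/
def HessVanishesAt (f : MvPolynomial (Fin 3) ℂ) (p : Fin 3 → ℂ) : Prop :=
  ∀ i j : Fin 3, eval p (pderiv i (pderiv j f)) = 0

/-- A ternary form is, modulo `X 2 ^ 2`, a binary form plus `X 2` times a binary form. -/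
theorem MvPolynomial.IsHomogeneous.exists_eq_add_X_two_mul {R : Type*} [CommSemiring R] {d : ℕ}
    {f : MvPolynomial (Fin 3) R} (hf : f.IsHomogeneous (d + 1)) :
    ∃ (a b : ℕ → R) (r : MvPolynomial (Fin 3) R),
      f = ∑ k ∈ Finset.range (d + 2), C (a k) * (X 0 ^ k * X 1 ^ (d + 1 - k)) +
        X 2 * ∑ k ∈ Finset.range (d + 1), C (b k) * (X 0 ^ k * X 1 ^ (d - k)) + X 2 ^ 2 * r := by
  rw [f.as_sum]
  refine Finset.sum_induction _ (fun g ↦ ∃ (a b : ℕ → R) (r : MvPolynomial (Fin 3) R),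
      g = ∑ k ∈ Finset.range (d + 2), C (a k) * (X 0 ^ k * X 1 ^ (d + 1 - k)) +
        X 2 * ∑ k ∈ Finset.range (d + 1), C (b k) * (X 0 ^ k * X 1 ^ (d - k)) + X 2 ^ 2 * r)
    ?_ ⟨0, 0, 0, by simp⟩ ?_
  · rintro _ _ ⟨a, b, r, rfl⟩ ⟨a', b', r', rfl⟩
    refine ⟨a + a', b + b', r + r', ?_⟩
    simp only [Pi.add_apply, C_add, add_mul, Finset.sum_add_distrib]
    ring
  · intro m hm
    have hdeg : m 0 + m 1 + m 2 = d + 1 := by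
      simpa [Finsupp.weight_apply, Finsupp.sum_fintype, Fin.sum_univ_three] using
        hf (mem_support_iff.1 hm)
    have hmon : monomial m (coeff m f) = C (coeff m f) * (X 0 ^ m 0 * X 1 ^ m 1 * X 2 ^ m 2) := by
      rw [monomial_eq, Finsupp.prod_fintype _ _ (by simp), Fin.prod_univ_three]
    rw [hmon]
    obtain h | h | h : m 2 = 0 ∨ m 2 = 1 ∨ 2 ≤ m 2 := by lia
    · refine ⟨Pi.single (m 0) (coeff m f), 0, 0, ?_⟩
      rw [Finset.sum_eq_single_of_mem (m 0) (Finset.mem_range.2 (by lia))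
        fun k _ hk ↦ by simp [Pi.single_eq_of_ne hk]]
      simp [h, show d + 1 - m 0 = m 1 by lia]
    · refine ⟨0, Pi.single (m 0) (coeff m f), 0, ?_⟩
      rw [Finset.sum_eq_single_of_mem (m 0) (s := Finset.range (d + 1))
        (Finset.mem_range.2 (by lia)) fun k _ hk ↦ by simp [Pi.single_eq_of_ne hk]]
      simp only [Pi.zero_apply, C_0, zero_mul, Finset.sum_const_zero, Pi.single_eq_same, h,
        show d - m 0 = m 1 by lia]
      ring
    · refine ⟨0, 0, C (coeff m f) * (X 0 ^ m 0 * X 1 ^ m 1 * X 2 ^ (m 2 - 2)), ?_⟩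
      obtain ⟨n, hn⟩ := Nat.exists_eq_add_of_le h
      simp only [Pi.zero_apply, C_0, zero_mul, Finset.sum_const_zero, hn, Nat.add_sub_cancel_left]
      ring

/-- If a homogeneous polynomial `f` of degree 6 in `ℂ[x₁,x₂,x₃]` has Hessian matrix vanishing
at the four points `(0,0,1)`, `(0,1,0)`, `(1,0,0)`, `(1,1,0)` (the last three of which lie on
the line `x₃ = 0`), then `f` is divisible by `x₃²`. -/
theorem dvd_of_hessVanishesAt_collinear (f : MvPolynomial (Fin 3) ℂ)
    (hf : f.IsHomogeneous 6)
    (h1 : HessVanishesAt f ![0, 0, 1]) (h2 : HessVanishesAt f ![0, 1, 0])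
    (h3 : HessVanishesAt f ![1, 0, 0]) (h4 : HessVanishesAt f ![1, 1, 0]) :
    (X 2 : MvPolynomial (Fin 3) ℂ) ^ 2 ∣ f := by
  obtain ⟨a, b, r, rfl⟩ := hf.exists_eq_add_X_two_mul
  have hnum (i : Fin 3) (n : ℕ) [n.AtLeastTwo] :
      pderiv i (OfNat.ofNat n : MvPolynomial (Fin 3) ℂ) = 0 :=
    Derivation.map_natCast _ n
  have h200 := h2 0 0
  have h201 := h2 0 1
  have h211 := h2 1 1
  have h202 := h2 0 2
  have h212 := h2 1 2
  have h300 := h3 0 0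
  have h301 := h3 0 1
  have h311 := h3 1 1
  have h302 := h3 0 2
  have h312 := h3 1 2
  have h400 := h4 0 0
  have h402 := h4 0 2
  have h412 := h4 1 2
  simp [Finset.sum_range_succ, pderiv_X, hnum]
    at h200 h201 h211 h202 h212 h300 h301 h311 h302 h312 h400 h402 h412
  simp only [h200, h202, h212, h300, h301, h311, h302, h312] at h400 h402 h412
  have ha3 : a 3 = 0 := by linear_combination h400 / 6
  have hb2 : b 2 = 0 := by linear_combination (3 * h412 - 2 * h402) / 5
  have hb3 : b 3 = 0 := by linear_combination (3 * h402 - 2 * h412) / 5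
  simp [Finset.sum_range_succ, h200, h201, h211, h202, h212, h300, h301, h311, h302, h312, ha3,
    hb2, hb3]
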